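/- Let A, B, C be finite-dimensional complex Hilbert spaces, let ρ_AB be a density operator on A⊗B, and let R_{B→BC} be a trace-preserving completely positive map from operators on B to operators on B⊗C, with marginal channel R_{B→B} := Tr_C ∘ R_{B→BC}. Then the infimum over all Markov chains μ_ABC (states with I(A:C|B)_μ = 0) of D_max( (id_A⊗R_{B→BC})(ρ_AB) ‖ μ_ABC ) is at most Λ_max(ρ_AB ‖ R_{B→B}). -/

import Mathlib

open scoped ComplexOrder

noncomputable section

namespace QIT

variable {n : Type*} [Fintype n] [DecidableEq n]

/-- `x ↦ x·log₂ x` with the convention `0·log 0 = 0`. -/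
def xlog (x : ℝ) : ℝ := if x = 0 then 0 else x * Real.logb 2 x

/-- Von Neumann entropy (base 2) of a matrix, via its eigenvalues. -/
def vN (ρ : Matrix n n ℂ) : ℝ :=
  if h : ρ.IsHermitian then -∑ i, xlog (h.eigenvalues i) else 0

/-- Matrix logarithm (base 2) via functional calculus on the support. -/
def matLog (ρ : Matrix n n ℂ) : Matrix n n ℂ :=
  if h : ρ.IsHermitian then
    (h.eigenvectorUnitary : Matrix n n ℂ) *
      Matrix.diagonal (fun i =>
        ((if h.eigenvalues i = 0 then 0 else Real.logb 2 (h.eigenvalues i) : ℝ) : ℂ)) *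
      (star (h.eigenvectorUnitary : Matrix n n ℂ))
  else 0

/-- Support inclusion: `supp ρ ⊆ supp σ` (for PSD matrices: `ker σ ⊆ ker ρ`). -/
def suppLe (ρ σ : Matrix n n ℂ) : Prop := ∀ v, σ.mulVec v = 0 → ρ.mulVec v = 0

open Classical in
/-- Umegaki relative entropy (base 2), `+∞` if the support condition fails. -/
def relEnt (ρ σ : Matrix n n ℂ) : EReal :=
  if suppLe ρ σ then (((ρ * (QIT.matLog ρ - QIT.matLog σ)).trace.re : ℝ) : EReal) else ⊤

/-- Max-relative entropy `D_max(ρ‖σ) = inf{λ : ρ ≤ 2^λ σ}`, `+∞` if no such λ. -/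
def dMax (ρ σ : Matrix n n ℂ) : EReal :=
  sInf {x : EReal | ∃ l : ℝ, x = (l : EReal) ∧ ((2 : ℝ) ^ l • σ - ρ).PosSemidef}

/-- Partial trace over the first tensor factor. -/
def ptrFst {α β : Type*} [Fintype α] (M : Matrix (α × β) (α × β) ℂ) : Matrix β β ℂ :=
  Matrix.of fun x y => ∑ i, M (i, x) (i, y)

/-- Partial trace over the second tensor factor. -/
def ptrSnd {α β : Type*} [Fintype β] (M : Matrix (α × β) (α × β) ℂ) : Matrix α α ℂ :=
  Matrix.of fun x y => ∑ k, M (x, k) (y, k)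

/-- Partial trace over the third factor of a tripartite system. -/
def ptrC3 {α β γ : Type*} [Fintype γ] (M : Matrix (α × β × γ) (α × β × γ) ℂ) :
    Matrix (α × β) (α × β) ℂ :=
  Matrix.of fun x y => ∑ k, M (x.1, x.2, k) (y.1, y.2, k)

/-- Conditional mutual information `I(A:C|B) = H(AB) + H(BC) - H(B) - H(ABC)`. -/
def cmi {α β γ : Type*} [Fintype α] [Fintype β] [Fintype γ]
    [DecidableEq α] [DecidableEq β] [DecidableEq γ]
    (ρ : Matrix (α × β × γ) (α × β × γ) ℂ) : ℝ :=
  vN (ptrC3 ρ) + vN (ptrFst ρ) - vN (ptrSnd (ptrFst ρ)) - vN ρ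

/-- Tensoring a map on the second factor with the identity on the first factor. -/
def tensorId {k b b' : Type*} (Φ : Matrix b b ℂ → Matrix b' b' ℂ)
    (M : Matrix (k × b) (k × b) ℂ) : Matrix (k × b') (k × b') ℂ :=
  Matrix.of fun x y => Φ (Matrix.of fun u v => M (x.1, u) (y.1, v)) x.2 y.2

/-- A quantum channel: linear, trace preserving and completely positive. -/
def IsCPTP {b b' : Type*} [Fintype b] [Fintype b']
    (Φ : Matrix b b ℂ →ₗ[ℂ] Matrix b' b' ℂ) : Prop :=
  (∀ M, (Φ M).trace = M.trace) ∧
    ∀ (k : ℕ) (M : Matrix (Fin k × b) (Fin k × b) ℂ), M.PosSemidef →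
      (tensorId (⇑Φ) M).PosSemidef

/-- `Λ_max(ρ_AB‖E)`: max-relative entropy distance from `ρ_AB` to the states
invariant under `id_A ⊗ E`. -/
def lambdaMax {a b : Type*} [Fintype a] [Fintype b]
    (ρ : Matrix (a × b) (a × b) ℂ) (E : Matrix b b ℂ → Matrix b b ℂ) : EReal :=
  ⨅ τ ∈ {τ : Matrix (a × b) (a × b) ℂ |
      τ.PosSemidef ∧ τ.trace = 1 ∧ tensorId E τ = τ}, dMax ρ τ

end QIT

namespace QIT

open Matrix Kronecker

/-- The variational functional behind the resolvent form of relative entropy. -/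
def cost {n : Type*} [Fintype n] [DecidableEq n] (t : ℝ) (ρ σ X : Matrix n n ℂ) : ℝ :=
  t * (ρ * ((1 - X)ᴴ * (1 - X))).trace.re + (σ * (X * Xᴴ)).trace.re

open scoped MatrixOrder in
theorem psd_factor {n : Type*} [Fintype n] [DecidableEq n] {S : Matrix n n ℂ}
    (hS : S.PosSemidef) : ∃ L : Matrix n n ℂ, S = Lᴴ * L :=
  (CStarAlgebra.nonneg_iff_eq_star_mul_self).mp hS.nonneg

theorem trace_mul_nonneg {n : Type*} [Fintype n] [DecidableEq n] {ρ S : Matrix n n ℂ}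
    (hρ : ρ.PosSemidef) (hS : S.PosSemidef) : 0 ≤ (ρ * S).trace.re := by
  obtain ⟨L, rfl⟩ := psd_factor hS
  rw [← Matrix.mul_assoc, Matrix.trace_mul_comm, ← Matrix.mul_assoc]
  have h := (hρ.mul_mul_conjTranspose_same L).trace_nonneg
  exact (Complex.le_def.mp h).1

theorem schwarz {n m ι : Type*} [Fintype n] [DecidableEq n] [Fintype m] [DecidableEq m]
    [Fintype ι] (K : ι → Matrix m n ℂ) (hK : ∑ l, (K l)ᴴ * K l = 1) (Z : Matrix m m ℂ) :
    ((∑ l, (K l)ᴴ * (Zᴴ * Z) * K l)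
      - (∑ l, (K l)ᴴ * Z * K l)ᴴ * (∑ l, (K l)ᴴ * Z * K l)).PosSemidef := by
  set T := ∑ l, (K l)ᴴ * Z * K l with hT
  have hT' : ∑ l, (K l)ᴴ * Zᴴ * K l = Tᴴ := by
    simp [hT, Matrix.conjTranspose_sum, Matrix.mul_assoc]
  have key : (∑ l, (K l)ᴴ * (Zᴴ * Z) * K l) - Tᴴ * T
      = ∑ l, (Z * K l - K l * T)ᴴ * (Z * K l - K l * T) := by
    have e : ∀ l, (Z * K l - K l * T)ᴴ * (Z * K l - K l * T)
        = (K l)ᴴ * (Zᴴ * Z) * K l - ((K l)ᴴ * Zᴴ * K l) * T - Tᴴ * ((K l)ᴴ * Z * K l)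
          + Tᴴ * ((K l)ᴴ * K l) * T := by
      intro l
      simp only [Matrix.conjTranspose_sub, Matrix.conjTranspose_mul, Matrix.sub_mul,
        Matrix.mul_sub, Matrix.mul_assoc]
      abel
    simp only [e, Finset.sum_add_distrib, Finset.sum_sub_distrib, ← Finset.sum_mul,
      ← Finset.mul_sum]
    rw [hK, hT', ← hT]
    simp
  rw [key]
  exact Matrix.posSemidef_sum _ fun l _ => Matrix.posSemidef_conjTranspose_mul_self _

theorem trace_schwarz {n m ι : Type*} [Fintype n] [DecidableEq n] [Fintype m] [DecidableEq m]
    [Fintype ι] (K : ι → Matrix m n ℂ) (hK : ∑ l, (K l)ᴴ * K l = 1) (Z : Matrix m m ℂ)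
    (ρ : Matrix n n ℂ) (hρ : ρ.PosSemidef) :
    (ρ * ((∑ l, (K l)ᴴ * Z * K l)ᴴ * (∑ l, (K l)ᴴ * Z * K l))).trace.re
      ≤ ((∑ l, K l * ρ * (K l)ᴴ) * (Zᴴ * Z)).trace.re := by
  have h := trace_mul_nonneg hρ (schwarz K hK Z)
  rw [Matrix.mul_sub, Matrix.trace_sub, Complex.sub_re] at h
  have e : (ρ * (∑ l, (K l)ᴴ * (Zᴴ * Z) * K l)).trace
      = ((∑ l, K l * ρ * (K l)ᴴ) * (Zᴴ * Z)).trace := by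
    rw [Matrix.mul_sum, Matrix.sum_mul, Matrix.trace_sum, Matrix.trace_sum]
    refine Finset.sum_congr rfl fun l _ => ?_
    rw [← Matrix.mul_assoc, Matrix.trace_mul_comm, Matrix.mul_assoc (K l) ρ,
      Matrix.mul_assoc (K l), Matrix.mul_assoc ρ]
  rw [e] at h
  linarith

theorem cost_mono {n m ι : Type*} [Fintype n] [DecidableEq n] [Fintype m] [DecidableEq m]
    [Fintype ι] (K : ι → Matrix m n ℂ) (hK : ∑ l, (K l)ᴴ * K l = 1) (Y : Matrix m m ℂ)
    (ρ σ : Matrix n n ℂ) (hρ : ρ.PosSemidef) (hσ : σ.PosSemidef) (t : ℝ) (ht : 0 < t) :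
    cost t ρ σ (∑ l, (K l)ᴴ * Y * K l)
      ≤ cost t (∑ l, K l * ρ * (K l)ᴴ) (∑ l, K l * σ * (K l)ᴴ) Y := by
  have h1 := trace_schwarz K hK (1 - Y) ρ hρ
  have h2 := trace_schwarz K hK Yᴴ σ hσ
  have e1 : ∑ l, (K l)ᴴ * (1 - Y) * K l = 1 - ∑ l, (K l)ᴴ * Y * K l := by
    simp [Matrix.mul_sub, Matrix.sub_mul, Finset.sum_sub_distrib, hK]
  have e2 : ∑ l, (K l)ᴴ * Yᴴ * K l = (∑ l, (K l)ᴴ * Y * K l)ᴴ := by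
    simp [Matrix.conjTranspose_sum, Matrix.mul_assoc]
  rw [e1] at h1
  rw [e2, Matrix.conjTranspose_conjTranspose, Matrix.conjTranspose_conjTranspose] at h2
  unfold cost
  have := mul_le_mul_of_nonneg_left h1 ht.le
  linarith

theorem trace_diag {n : Type*} [Fintype n] [DecidableEq n] (p : n → ℝ) (Z : Matrix n n ℂ) :
    (Matrix.diagonal (fun i => (p i : ℂ)) * (Zᴴ * Z)).trace.re
      = ∑ j, ∑ i, p i * Complex.normSq (Z j i) := by
  rw [Finset.sum_comm]
  simp only [Matrix.trace, Matrix.diag, Matrix.diagonal_mul, Complex.re_sum]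
  refine Finset.sum_congr rfl fun i _ => ?_
  rw [Matrix.mul_apply, Finset.mul_sum, Complex.re_sum]
  refine Finset.sum_congr rfl fun j _ => ?_
  simp [Complex.normSq_apply]

theorem cost_eq {n : Type*} [Fintype n] [DecidableEq n] (t : ℝ) (U V : Matrix n n ℂ)
    (hU : Uᴴ * U = 1) (hU' : U * Uᴴ = 1) (hV : Vᴴ * V = 1) (hV' : V * Vᴴ = 1)
    (p q : n → ℝ) (X : Matrix n n ℂ) :
    cost t (U * Matrix.diagonal (fun i => (p i : ℂ)) * Uᴴ)
      (V * Matrix.diagonal (fun i => (q i : ℂ)) * Vᴴ) (V * X * Uᴴ)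
    = ∑ j, ∑ i, (t * p i * Complex.normSq ((Vᴴ * U) j i - X j i)
        + q j * Complex.normSq (X j i)) := by
  have e1 : (1 : Matrix n n ℂ) - V * X * Uᴴ = V * (Vᴴ * U - X) * Uᴴ := by
    rw [Matrix.mul_sub, Matrix.sub_mul, ← Matrix.mul_assoc V, hV', Matrix.one_mul, hU']
  have key : ∀ (U V : Matrix n n ℂ), Uᴴ * U = 1 → Vᴴ * V = 1 → ∀ (p : n → ℝ) (Z : Matrix n n ℂ),
      (U * Matrix.diagonal (fun i => (p i : ℂ)) * Uᴴ * ((V * Z * Uᴴ)ᴴ * (V * Z * Uᴴ))).trace.re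
        = ∑ j, ∑ i, p i * Complex.normSq (Z j i) := by
    intro U V hU hV p Z
    rw [← trace_diag]
    have : U * Matrix.diagonal (fun i => (p i : ℂ)) * Uᴴ * ((V * Z * Uᴴ)ᴴ * (V * Z * Uᴴ))
        = U * (Matrix.diagonal (fun i => (p i : ℂ)) * (Uᴴ * U) * Zᴴ * (Vᴴ * V) * Z * Uᴴ) := by
      simp only [Matrix.conjTranspose_mul, Matrix.conjTranspose_conjTranspose, Matrix.mul_assoc]
    rw [this, Matrix.trace_mul_comm, hU, hV, Matrix.mul_assoc _ Uᴴ U, hU]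
    simp only [Matrix.mul_one, Matrix.mul_assoc]
  unfold cost
  rw [e1, key U V hU hV]
  have e2 : (V * X * Uᴴ) * (V * X * Uᴴ)ᴴ = (U * Xᴴ * Vᴴ)ᴴ * (U * Xᴴ * Vᴴ) := by
    simp only [Matrix.conjTranspose_mul, Matrix.conjTranspose_conjTranspose, Matrix.mul_assoc]
  rw [e2, key V U hV hU, Finset.sum_comm (f := fun j i => q i * Complex.normSq (Xᴴ j i)),
    Finset.mul_sum, ← Finset.sum_add_distrib]
  refine Finset.sum_congr rfl fun j _ => ?_
  rw [Finset.mul_sum, ← Finset.sum_add_distrib]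
  refine Finset.sum_congr rfl fun i _ => ?_
  simp [Complex.normSq_apply, mul_assoc]

theorem scalar_le (a q : ℝ) (ha : 0 ≤ a) (hq : 0 ≤ q) (w z : ℂ) :
    Complex.normSq w * (a * q / (a + q)) ≤ a * Complex.normSq (w - z) + q * Complex.normSq z := by
  rcases (add_nonneg ha hq).eq_or_lt with h | h
  · rw [← h]
    simp only [div_zero, mul_zero]
    have := Complex.normSq_nonneg (w - z)
    have := Complex.normSq_nonneg z
    positivity
  · rw [← mul_div_assoc, div_le_iff₀ h]
    simp only [Complex.normSq_apply, Complex.sub_re, Complex.sub_im]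
    nlinarith [sq_nonneg ((a + q) * z.re - a * w.re), sq_nonneg ((a + q) * z.im - a * w.im)]

theorem scalar_eq (a q : ℝ) (ha : 0 ≤ a) (hq : 0 ≤ q) (w : ℂ) :
    a * Complex.normSq (w - ((a / (a + q) : ℝ) : ℂ) * w)
      + q * Complex.normSq (((a / (a + q) : ℝ) : ℂ) * w)
      = Complex.normSq w * (a * q / (a + q)) := by
  rcases (add_nonneg ha hq).eq_or_lt with h | h
  · have h1 : a = 0 := by linarith
    have h2 : q = 0 := by linarith
    simp [h1, h2]
  · have : w - ((a / (a + q) : ℝ) : ℂ) * w = ((1 - a / (a + q) : ℝ) : ℂ) * w := by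
      push_cast; ring
    rw [this, Complex.normSq_mul, Complex.normSq_mul, Complex.normSq_ofReal, Complex.normSq_ofReal]
    field_simp
    ring

/-- Partial fractions: the Stieltjes transform determines the finite measure. -/
theorem stieltjes {ι : Type*} [Fintype ι] (c x : ι → ℝ) (hx : ∀ i, 0 < x i)
    (h : ∀ t : ℝ, 0 < t → ∑ i, c i * (t * x i / (t + x i)) = 0) (f : ℝ → ℝ) :
    ∑ i, c i * f (x i) = 0 := by
  classical
  set S := Finset.univ.image x with hS
  set m : ℝ → ℝ := fun s => ∑ i with x i = s, c i with hm
  have grp : ∀ g : ℝ → ℝ, ∑ i, c i * g (x i) = ∑ s ∈ S, m s * g s := by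
    intro g
    rw [← Finset.sum_fiberwise_of_maps_to (s := Finset.univ) (t := S) (g := x)
      (fun i _ => Finset.mem_image_of_mem _ (Finset.mem_univ i))]
    refine Finset.sum_congr rfl fun s _ => ?_
    rw [hm, Finset.sum_mul]
    refine Finset.sum_congr rfl fun i hi => ?_
    rw [(Finset.mem_filter.mp hi).2]
  have pos : ∀ s ∈ S, 0 < s := by
    intro s hs
    obtain ⟨i, _, rfl⟩ := Finset.mem_image.mp hs
    exact hx i
  let P : Polynomial ℝ := ∑ s ∈ S, Polynomial.C (m s * s) *
    ∏ r ∈ S.erase s, (Polynomial.X + Polynomial.C r)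
  have hP : P = 0 := by
    refine Polynomial.eq_zero_of_infinite_isRoot P ((Set.Ioi_infinite (0 : ℝ)).mono ?_)
    intro t ht
    have ht : 0 < t := ht
    have h1 := h t ht
    rw [grp (fun y => t * y / (t + y))] at h1
    show P.eval t = 0
    have : P.eval t = (∑ s ∈ S, m s * (t * s / (t + s))) * (∏ r ∈ S, (t + r)) / t := by
      simp only [P, Polynomial.eval_finsetSum, Polynomial.eval_mul, Polynomial.eval_C,
        Polynomial.eval_prod, Polynomial.eval_add, Polynomial.eval_X]
      rw [Finset.sum_mul, Finset.sum_div]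
      refine Finset.sum_congr rfl fun s hs => ?_
      rw [← Finset.mul_prod_erase S _ hs]
      have := pos s hs
      field_simp
    rw [this, h1]
    simp
  have hm0 : ∀ s ∈ S, m s = 0 := by
    intro s hs
    have h1 : P.eval (-s) = 0 := by rw [hP]; simp
    simp only [P, Polynomial.eval_finsetSum, Polynomial.eval_mul, Polynomial.eval_C,
        Polynomial.eval_prod, Polynomial.eval_add, Polynomial.eval_X] at h1
    rw [Finset.sum_eq_single_of_mem s hs] at h1
    · have hne : ∏ r ∈ S.erase s, (-s + r) ≠ 0 := by
        refine Finset.prod_ne_zero_iff.mpr fun r hr => ?_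
        have := (Finset.mem_erase.mp hr).1
        intro h0
        exact this (by linarith)
      have h2 := (mul_eq_zero.mp h1).resolve_right hne
      exact (mul_eq_zero.mp h2).resolve_right (pos s hs).ne'
    · intro r hr hrs
      rw [Finset.prod_eq_zero (Finset.mem_erase.mpr ⟨hrs.symm, hs⟩) (by ring), mul_zero]
  rw [grp]
  exact Finset.sum_eq_zero fun s hs => by rw [hm0 s hs, zero_mul]

theorem kron_block {k b b' : Type*} [Fintype k] [DecidableEq k] [Fintype b]
    (K : Matrix b' b ℂ) (M : Matrix (k × b) (k × b) ℂ) (x y : k × b') :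
    (((1 : Matrix k k ℂ) ⊗ₖ K) * M * ((1 : Matrix k k ℂ) ⊗ₖ K)ᴴ) x y
      = (K * (Matrix.of fun u v => M (x.1, u) (y.1, v)) * Kᴴ) x.2 y.2 := by
  simp only [Matrix.mul_apply, Fintype.sum_prod_type, Matrix.one_apply, Finset.sum_mul,
    Matrix.kroneckerMap_apply, Matrix.conjTranspose_apply, Matrix.of_apply]
  rw [Finset.sum_eq_single_of_mem y.1 (Finset.mem_univ _)]
  · refine Finset.sum_congr rfl fun v _ => ?_
    rw [Finset.sum_eq_single_of_mem x.1 (Finset.mem_univ _)]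
    · simp
    · intro a _ ha
      simp [ha.symm]
  · intro a _ ha
    simp [ha.symm]

theorem ptrFst_kron {k b b' : Type*} [Fintype k] [DecidableEq k] [Fintype b]
    (K : Matrix b' b ℂ) (M : Matrix (k × b) (k × b) ℂ) :
    ptrFst (((1 : Matrix k k ℂ) ⊗ₖ K) * M * ((1 : Matrix k k ℂ) ⊗ₖ K)ᴴ) = K * ptrFst M * Kᴴ := by
  have : ptrFst M = ∑ i, Matrix.of fun u v => M (i, u) (i, v) := by
    ext u v; simp [ptrFst, Matrix.sum_apply]
  ext x y
  rw [this, Matrix.mul_sum, Matrix.sum_mul, Matrix.sum_apply]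
  simp only [ptrFst, Matrix.of_apply, kron_block]

theorem ptrFst_posSemidef {k b : Type*} [Fintype k] [Fintype b]
    (M : Matrix (k × b) (k × b) ℂ) (hM : M.PosSemidef) : (ptrFst M).PosSemidef := by
  have : ptrFst M = ∑ i, M.submatrix (fun u => (i, u)) (fun u => (i, u)) := by
    ext u v; simp [ptrFst, Matrix.sum_apply]
  rw [this]
  exact Matrix.posSemidef_sum _ fun i _ => hM.submatrix _

theorem xlog_eq (x : ℝ) : xlog x = x * Real.logb 2 x := by
  unfold xlog; split_ifs with h <;> simp [h]

theorem key_data {k b : Type*} [Fintype k] [DecidableEq k] [Fintype b] [DecidableEq b]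
    (ρ : Matrix (k × b) (k × b) ℂ) (hρ : ρ.PosSemidef) :
    ∃ c x : (k × b) × (k × b) → ℝ, (∀ i, 0 < x i) ∧
      (vN (ptrFst ρ) - vN ρ = - ∑ i, c i * Real.logb 2 (x i)) ∧
      ∀ t : ℝ, 0 < t →
        (∀ X, ∑ i, c i * (t * x i / (t + x i)) ≤ cost t ρ ((1 : Matrix k k ℂ) ⊗ₖ ptrFst ρ) X) ∧
        (∃ X, cost t ρ ((1 : Matrix k k ℂ) ⊗ₖ ptrFst ρ) X = ∑ i, c i * (t * x i / (t + x i))) := by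
  have hB := ptrFst_posSemidef ρ hρ
  set σ := ptrFst ρ with hσ
  set p := hρ.1.eigenvalues with hp
  set qb := hB.1.eigenvalues with hqb
  set U : Matrix (k × b) (k × b) ℂ := (hρ.1.eigenvectorUnitary : Matrix (k × b) (k × b) ℂ) with hUdef
  set VB : Matrix b b ℂ := (hB.1.eigenvectorUnitary : Matrix b b ℂ) with hVBdef
  have hp0 : ∀ i, 0 ≤ p i := hρ.eigenvalues_nonneg
  have hq0 : ∀ j, 0 ≤ qb j := hB.eigenvalues_nonneg
  have hU : Uᴴ * U = 1 := Unitary.coe_star_mul_self hρ.1.eigenvectorUnitary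
  have hU' : U * Uᴴ = 1 := Unitary.coe_mul_star_self hρ.1.eigenvectorUnitary
  have hVB : VBᴴ * VB = 1 := Unitary.coe_star_mul_self hB.1.eigenvectorUnitary
  have hVB' : VB * VBᴴ = 1 := Unitary.coe_mul_star_self hB.1.eigenvectorUnitary
  have specρ : ρ = U * Matrix.diagonal (fun i => (p i : ℂ)) * Uᴴ := by
    have := hρ.1.spectral_theorem
    rw [Unitary.conjStarAlgAut_apply] at this
    exact this
  have specσ : σ = VB * Matrix.diagonal (fun i => (qb i : ℂ)) * VBᴴ := by
    have := hB.1.spectral_theorem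
    rw [Unitary.conjStarAlgAut_apply] at this
    exact this
  set V : Matrix (k × b) (k × b) ℂ := (1 : Matrix k k ℂ) ⊗ₖ VB with hVdef
  have hVh : Vᴴ = (1 : Matrix k k ℂ) ⊗ₖ VBᴴ := by
    rw [hVdef, Matrix.conjTranspose_kronecker, Matrix.conjTranspose_one]
  have hV : Vᴴ * V = 1 := by
    rw [hVh, hVdef, ← Matrix.mul_kronecker_mul, hVB, Matrix.one_mul, Matrix.one_kronecker_one]
  have hV' : V * Vᴴ = 1 := by
    rw [hVh, hVdef, ← Matrix.mul_kronecker_mul, hVB', Matrix.one_mul, Matrix.one_kronecker_one]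
  let q : k × b → ℝ := fun j => qb j.2
  have specσ' : (1 : Matrix k k ℂ) ⊗ₖ σ = V * Matrix.diagonal (fun i => (q i : ℂ)) * Vᴴ := by
    have : Matrix.diagonal (fun i => (q i : ℂ))
        = (1 : Matrix k k ℂ) ⊗ₖ Matrix.diagonal (fun i => (qb i : ℂ)) := by
      rw [← Matrix.diagonal_one, Matrix.diagonal_kronecker_diagonal]
      simp [q]
    rw [this, hVh, hVdef, ← Matrix.mul_kronecker_mul, ← Matrix.mul_kronecker_mul, ← specσ]
    simp
  set W := Vᴴ * U with hW
  let w : k × b → k × b → ℝ := fun j i => Complex.normSq (W j i)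
  have hw0 : ∀ j i, 0 ≤ w j i := fun j i => Complex.normSq_nonneg _
  have hwcol : ∀ i, ∑ j, w j i = 1 := by
    intro i
    have h1 : Wᴴ * W = 1 := by
      rw [hW, Matrix.conjTranspose_mul, Matrix.conjTranspose_conjTranspose, Matrix.mul_assoc,
        ← Matrix.mul_assoc V, hV', Matrix.one_mul, hU]
    have h2 := congrArg Complex.re (congrFun (congrFun h1 i) i)
    simpa [Matrix.mul_apply, Complex.normSq_apply, w] using h2
  have hwrow : ∀ j, ∑ a, ∑ i, w (a, j) i * p i = qb j := by
    intro j
    have h1 : ptrFst (((1 : Matrix k k ℂ) ⊗ₖ VBᴴ) * ρ * ((1 : Matrix k k ℂ) ⊗ₖ VBᴴ)ᴴ)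
        = Matrix.diagonal (fun i => (qb i : ℂ)) := by
      rw [ptrFst_kron, ← hσ, specσ, Matrix.conjTranspose_conjTranspose]
      have : VBᴴ * (VB * Matrix.diagonal (fun i => (qb i : ℂ)) * VBᴴ) * VB
        = (VBᴴ * VB) * Matrix.diagonal (fun i => (qb i : ℂ)) * (VBᴴ * VB) := by
        simp only [Matrix.mul_assoc]
      rw [this, hVB]; simp
    have h3 : ((1 : Matrix k k ℂ) ⊗ₖ VBᴴ) * ρ * ((1 : Matrix k k ℂ) ⊗ₖ VBᴴ)ᴴ
        = W * Matrix.diagonal (fun i => (p i : ℂ)) * Wᴴ := by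
      rw [← hVh, hW, Matrix.conjTranspose_mul, specρ]
      simp only [Matrix.mul_assoc]
    rw [h3] at h1
    have h2 := congrArg Complex.re (congrFun (congrFun h1 j) j)
    simp only [ptrFst, Matrix.of_apply, Matrix.diagonal_apply_eq, Complex.ofReal_re,
      Complex.re_sum] at h2
    rw [← h2]
    refine Finset.sum_congr rfl fun a _ => ?_
    rw [Matrix.mul_apply, Complex.re_sum]
    refine Finset.sum_congr rfl fun i _ => ?_
    simp [w, Complex.normSq_apply]
    ring
  have hsupp : ∀ j i, q j = 0 → w j i * p i = 0 := by
    rintro ⟨a, j⟩ i hq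
    have h1 : ∑ a, ∑ i, w (a, j) i * p i = 0 := (hwrow j).trans hq
    have nn : ∀ a i, 0 ≤ w (a, j) i * p i := fun a i => mul_nonneg (hw0 _ _) (hp0 _)
    rw [Finset.sum_eq_zero_iff_of_nonneg
      (fun a _ => Finset.sum_nonneg fun i _ => nn a i)] at h1
    have h2 := h1 a (Finset.mem_univ a)
    rw [Finset.sum_eq_zero_iff_of_nonneg (fun i _ => nn a i)] at h2
    exact h2 i (Finset.mem_univ i)
  let x : (k × b) × (k × b) → ℝ := fun ji =>
    if 0 < p ji.2 ∧ 0 < q ji.1 then q ji.1 / p ji.2 else 1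
  let c : (k × b) × (k × b) → ℝ := fun ji => w ji.1 ji.2 * p ji.2
  have hc0 : ∀ ji, ¬ (0 < p ji.2 ∧ 0 < q ji.1) → c ji = 0 := by
    rintro ⟨j, i⟩ h
    rcases (hp0 i).eq_or_lt with h1 | h1
    · simp [c, ← h1]
    · have : q j = 0 := by
        by_contra h2
        exact h ⟨h1, lt_of_le_of_ne (hq0 _) (Ne.symm h2)⟩
      exact hsupp j i this
  have hform : ∀ t : ℝ, 0 < t → ∑ i, c i * (t * x i / (t + x i))
      = ∑ j, ∑ i, Complex.normSq (W j i) * ((t * p i) * q j / (t * p i + q j)) := by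
    intro t ht
    rw [Fintype.sum_prod_type]
    refine Finset.sum_congr rfl fun j _ => Finset.sum_congr rfl fun i _ => ?_
    by_cases h : 0 < p i ∧ 0 < q j
    · have : x (j, i) = q j / p i := if_pos h
      rw [this]
      obtain ⟨h1, h2⟩ := h
      simp only [c, w]
      field_simp
    · rw [hc0 (j, i) h, zero_mul]
      by_cases h1 : 0 < p i
      · have : q j = 0 := by
          by_contra h2
          exact h ⟨h1, lt_of_le_of_ne (hq0 _) (Ne.symm h2)⟩
        simp [this]
      · have : p i = 0 := le_antisymm (not_lt.mp h1) (hp0 i)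
        simp [this]
  refine ⟨c, x, ?_, ?_, ?_⟩
  · intro ji
    simp only [x]
    split_ifs with h
    · exact div_pos h.2 h.1
    · exact one_pos
  · have e1 : ∀ ji, c ji * Real.logb 2 (x ji)
        = w ji.1 ji.2 * p ji.2 * Real.logb 2 (q ji.1)
          - w ji.1 ji.2 * (p ji.2 * Real.logb 2 (p ji.2)) := by
      intro ji
      by_cases h : 0 < p ji.2 ∧ 0 < q ji.1
      · have : x ji = q ji.1 / p ji.2 := if_pos h
        rw [this, Real.logb_div h.2.ne' h.1.ne']
        simp only [c]; ring
      · have h0 := hc0 ji h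
        rw [h0]
        have h0' : w ji.1 ji.2 * p ji.2 = 0 := h0
        rw [h0', ← mul_assoc, h0']; simp
    simp only [e1, Finset.sum_sub_distrib]
    have e2 : ∑ ji : (k × b) × (k × b), w ji.1 ji.2 * p ji.2 * Real.logb 2 (q ji.1)
        = ∑ j, qb j * Real.logb 2 (qb j) := by
      rw [Fintype.sum_prod_type, Fintype.sum_prod_type, Finset.sum_comm]
      refine Finset.sum_congr rfl fun j _ => ?_
      simp only [q, ← Finset.sum_mul]
      rw [hwrow]
    have e3 : ∑ ji : (k × b) × (k × b), w ji.1 ji.2 * (p ji.2 * Real.logb 2 (p ji.2))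
        = ∑ i, p i * Real.logb 2 (p i) := by
      rw [Fintype.sum_prod_type, Finset.sum_comm]
      refine Finset.sum_congr rfl fun i _ => ?_
      simp only [← Finset.sum_mul]
      rw [hwcol, one_mul]
    rw [e2, e3, vN, vN, dif_pos hB.1, dif_pos hρ.1]
    simp only [xlog_eq]
    simp only [hp, hqb]
    ring
  · intro t ht
    rw [hform t ht]
    have hcost : ∀ X, cost t ρ ((1 : Matrix k k ℂ) ⊗ₖ σ) (V * X * Uᴴ)
        = ∑ j, ∑ i, (t * p i * Complex.normSq (W j i - X j i)
        + q j * Complex.normSq (X j i)) := by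
      intro X
      have := cost_eq t U V hU hU' hV hV' p q X
      rw [← specρ, ← specσ'] at this
      exact this
    constructor
    · intro X
      have hX : X = V * (Vᴴ * X * U) * Uᴴ := by
        have : V * (Vᴴ * X * U) * Uᴴ = (V * Vᴴ) * X * (U * Uᴴ) := by
          simp only [Matrix.mul_assoc]
        rw [this, hV', hU']; simp
      rw [hX, hcost]
      exact Finset.sum_le_sum fun j _ => Finset.sum_le_sum fun i _ =>
        scalar_le _ _ (mul_nonneg ht.le (hp0 i)) (hq0 _) _ _
    · refine ⟨V * (Matrix.of fun j i => ((t * p i / (t * p i + q j) : ℝ) : ℂ) * W j i) * Uᴴ, ?_⟩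
      rw [hcost]
      exact Finset.sum_congr rfl fun j _ => Finset.sum_congr rfl fun i _ =>
        scalar_eq _ _ (mul_nonneg ht.le (hp0 i)) (hq0 _) _

theorem entropy_eq {k b k' b' ι κ : Type*} [Fintype k] [DecidableEq k] [Fintype b] [DecidableEq b]
    [Fintype k'] [DecidableEq k'] [Fintype b'] [DecidableEq b'] [Fintype ι] [Fintype κ]
    (ρ : Matrix (k × b) (k × b) ℂ) (hρ : ρ.PosSemidef)
    (ρ' : Matrix (k' × b') (k' × b') ℂ) (hρ' : ρ'.PosSemidef)
    (K : ι → Matrix (k' × b') (k × b) ℂ) (hK : ∑ l, (K l)ᴴ * K l = 1)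
    (L : κ → Matrix (k × b) (k' × b') ℂ) (hL : ∑ l, (L l)ᴴ * L l = 1)
    (h1 : ∑ l, K l * ρ * (K l)ᴴ = ρ')
    (h2 : ∑ l, K l * ((1 : Matrix k k ℂ) ⊗ₖ ptrFst ρ) * (K l)ᴴ
      = (1 : Matrix k' k' ℂ) ⊗ₖ ptrFst ρ')
    (h3 : ∑ l, L l * ρ' * (L l)ᴴ = ρ)
    (h4 : ∑ l, L l * ((1 : Matrix k' k' ℂ) ⊗ₖ ptrFst ρ') * (L l)ᴴ
      = (1 : Matrix k k ℂ) ⊗ₖ ptrFst ρ) :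
    vN (ptrFst ρ) - vN ρ = vN (ptrFst ρ') - vN ρ' := by
  obtain ⟨c, x, hx, he, hF⟩ := key_data ρ hρ
  obtain ⟨c', x', hx', he', hF'⟩ := key_data ρ' hρ'
  have hs : ((1 : Matrix k k ℂ) ⊗ₖ ptrFst ρ).PosSemidef :=
    Matrix.PosSemidef.one.kronecker (ptrFst_posSemidef ρ hρ)
  have hs' : ((1 : Matrix k' k' ℂ) ⊗ₖ ptrFst ρ').PosSemidef :=
    Matrix.PosSemidef.one.kronecker (ptrFst_posSemidef ρ' hρ')
  have heq : ∀ t : ℝ, 0 < t →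
      ∑ i, c i * (t * x i / (t + x i)) = ∑ i, c' i * (t * x' i / (t + x' i)) := by
    intro t ht
    apply le_antisymm
    · obtain ⟨Y, hY⟩ := (hF' t ht).2
      have := cost_mono K hK Y ρ _ hρ hs t ht
      rw [h1, h2] at this
      exact ((hF t ht).1 _).trans (this.trans hY.le)
    · obtain ⟨Y, hY⟩ := (hF t ht).2
      have := cost_mono L hL Y ρ' _ hρ' hs' t ht
      rw [h3, h4] at this
      exact ((hF' t ht).1 _).trans (this.trans hY.le)
  have := stieltjes (Sum.elim c (fun i => - c' i)) (Sum.elim x x')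
    (by rintro (i | i); exacts [hx i, hx' i])
    (by
      intro t ht
      rw [Fintype.sum_sum_type]
      simp only [Sum.elim_inl, Sum.elim_inr, neg_mul, Finset.sum_neg_distrib]
      rw [heq t ht]; ring) (Real.logb 2)
  rw [Fintype.sum_sum_type] at this
  simp only [Sum.elim_inl, Sum.elim_inr, neg_mul, Finset.sum_neg_distrib] at this
  linarith

theorem exists_kraus {b b' : Type*} [Fintype b] [Fintype b'] [DecidableEq b] [DecidableEq b']
    (R : Matrix b b ℂ →ₗ[ℂ] Matrix b' b' ℂ) (hR : IsCPTP R) :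
    ∃ K : Fin (Fintype.card b) × b' → Matrix b' b ℂ,
      (∀ M, R M = ∑ l, K l * M * (K l)ᴴ) ∧ ∑ l, (K l)ᴴ * K l = 1 := by
  let e := Fintype.equivFin b
  let v : Fin (Fintype.card b) × b → ℂ := fun z => if e z.2 = z.1 then 1 else 0
  have hJ := hR.2 _ (Matrix.vecMulVec v (star v)) (Matrix.posSemidef_vecMulVec_self_star v)
  obtain ⟨L, hL⟩ := psd_factor hJ
  have hE : ∀ i j x y, R (Matrix.single i j 1) x y
      = ∑ l, star (L l (e i, x)) * L l (e j, y) := by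
    intro i j x y
    have := congrFun (congrFun hL (e i, x)) (e j, y)
    rw [Matrix.mul_apply] at this
    simp only [Matrix.conjTranspose_apply] at this
    rw [← this]
    simp only [tensorId, Matrix.of_apply]
    refine congrFun (congrFun (congrArg R ?_) x) y
    ext u w
    simp only [Matrix.vecMulVec_apply, v, Matrix.of_apply, Matrix.single_apply, Pi.star_apply,
      EmbeddingLike.apply_eq_iff_eq]
    by_cases h1 : u = i <;> by_cases h2 : w = j <;>
      simp [h1, h2, eq_comm (a := i), eq_comm (a := j)]
  let K : Fin (Fintype.card b) × b' → Matrix b' b ℂ := fun l =>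
    Matrix.of fun x i => star (L l (e i, x))
  have hK : ∀ M, R M = ∑ l, K l * M * (K l)ᴴ := by
    intro M
    ext x y
    have hM : M = ∑ i, ∑ j, M i j • Matrix.single i j (1 : ℂ) := by
      conv_lhs => rw [Matrix.matrix_eq_sum_single M]
      simp [Matrix.smul_single]
    conv_lhs => rw [hM]
    simp only [map_sum, map_smul, Matrix.sum_apply, Matrix.smul_apply, hE, smul_eq_mul,
      Matrix.mul_apply, Finset.sum_mul, Finset.mul_sum, K, Matrix.of_apply,
      Matrix.conjTranspose_apply, star_star]
    rw [Finset.sum_comm]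
    conv_lhs => enter [2, j]; rw [Finset.sum_comm]
    rw [Finset.sum_comm]
    refine Finset.sum_congr rfl fun l _ => Finset.sum_congr rfl fun j _ =>
      Finset.sum_congr rfl fun i _ => ?_
    ring
  refine ⟨K, hK, ?_⟩
  refine Matrix.ext_iff_trace_mul_right.mpr fun M => ?_
  rw [Matrix.one_mul, ← hR.1 M, hK, Matrix.sum_mul, Matrix.trace_sum, Matrix.trace_sum]
  refine Finset.sum_congr rfl fun l _ => ?_
  rw [Matrix.mul_assoc, Matrix.trace_mul_comm]

end QIT

open scoped Matrix Kronecker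

open QIT in
/-- the infimum over Markov chains `μ_ABC` of
`D_max((id_A⊗R_{B→BC})(ρ_AB) ‖ μ_ABC)` is at most `Λ_max(ρ_AB ‖ R_{B→B})`. -/
theorem inf_dMax_markov_le_lambdaMax {A B C : Type*} [Fintype A] [Fintype B] [Fintype C]
    [DecidableEq A] [DecidableEq B] [DecidableEq C]
    (ρAB : Matrix (A × B) (A × B) ℂ) (hρAB : ρAB.PosSemidef) (hρAB1 : ρAB.trace = 1)
    (R : Matrix B B ℂ →ₗ[ℂ] Matrix (B × C) (B × C) ℂ) (hR : IsCPTP R) :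
    (⨅ μ ∈ {μ : Matrix (A × B × C) (A × B × C) ℂ |
        μ.PosSemidef ∧ μ.trace = 1 ∧ cmi μ = 0}, dMax (tensorId (⇑R) ρAB) μ)
      ≤ lambdaMax ρAB (fun M => ptrSnd (R M)) := by
  classical
  obtain ⟨K, hK, hK1⟩ := exists_kraus R hR
  let K' : Fin (Fintype.card B) × B × C → Matrix (A × B × C) (A × B) ℂ :=
    fun l => (1 : Matrix A A ℂ) ⊗ₖ K l
  have hK'1 : ∑ l, (K' l)ᴴ * K' l = 1 := by
    have : ∀ l, (K' l)ᴴ * K' l = (1 : Matrix A A ℂ) ⊗ₖ ((K l)ᴴ * K l) := by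
      intro l
      simp only [K']
      rw [Matrix.conjTranspose_kronecker, ← Matrix.mul_kronecker_mul]
      simp
    simp only [this]
    ext x y
    have h := congrFun (congrFun hK1 x.2) y.2
    rw [Matrix.sum_apply] at h
    simp only [Matrix.sum_apply, Matrix.kroneckerMap_apply, ← Finset.mul_sum, h]
    rw [← Matrix.one_kronecker_one, Matrix.kroneckerMap_apply]
  have hT : ∀ M : Matrix (A × B) (A × B) ℂ, tensorId (⇑R) M = ∑ l, K' l * M * Matrix.conjTranspose (K' l) := by
    intro M
    ext x y
    simp only [tensorId, Matrix.of_apply, hK, Matrix.sum_apply, K', kron_block]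
  have hTpos : ∀ M : Matrix (A × B) (A × B) ℂ, M.PosSemidef → (tensorId (⇑R) M).PosSemidef := by
    intro M hM
    rw [hT]
    exact Matrix.posSemidef_sum _ fun l _ => hM.mul_mul_conjTranspose_same _
  unfold lambdaMax
  refine le_iInf₂ fun τ hτ => ?_
  obtain ⟨hτ0, hτ1, hτE⟩ := hτ
  have hpC : ptrC3 (tensorId (⇑R) τ) = τ := hτE
  have hpF : ptrFst (tensorId (⇑R) τ) = R (ptrFst τ) := by
    have h : ptrFst τ = ∑ i, Matrix.of fun u v => τ (i, u) (i, v) := by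
      ext u v; simp [ptrFst, Matrix.sum_apply]
    rw [h, map_sum]
    ext u v
    simp [ptrFst, tensorId, Matrix.sum_apply]
  have hpB : ptrSnd (R (ptrFst τ)) = ptrFst τ := by
    rw [← hpF]
    conv_rhs => rw [← hpC]
    ext u v
    simp only [ptrSnd, ptrFst, ptrC3, Matrix.of_apply]
    rw [Finset.sum_comm]
  have htr : (tensorId (⇑R) τ).trace = 1 := by
    rw [← hτ1]
    conv_rhs => rw [← hpC]
    simp [Matrix.trace, ptrC3, Fintype.sum_prod_type]
  let L : C → Matrix (A × B) (A × B × C) ℂ := fun c =>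
    (1 : Matrix (A × B × C) (A × B × C) ℂ).submatrix (fun x => (x.1, x.2, c)) id
  have hLM : ∀ M : Matrix (A × B × C) (A × B × C) ℂ, ∑ l, L l * M * (L l)ᴴ = ptrC3 M := by
    intro M
    ext x y
    simp only [Matrix.sum_apply, ptrC3, Matrix.of_apply]
    refine Finset.sum_congr rfl fun c _ => ?_
    simp only [Matrix.mul_apply, L, Matrix.submatrix_apply, id, Matrix.one_apply,
      Matrix.conjTranspose_apply, apply_ite star, star_one, star_zero, ite_mul, mul_ite,
      one_mul, mul_one, zero_mul, mul_zero, Finset.sum_ite_eq, Finset.mem_univ, if_true]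
  have hL1 : ∑ l, (L l)ᴴ * L l = 1 := by
    have h : (1 : Matrix (A × B × C) (A × B × C) ℂ)ᴴ * 1 = 1 := by simp
    rw [← h]
    ext x y
    simp only [Matrix.sum_apply, Matrix.mul_apply, L, Matrix.conjTranspose_apply,
      Matrix.submatrix_apply, id, Fintype.sum_prod_type]
    rw [Finset.sum_comm]
    refine Finset.sum_congr rfl fun a _ => ?_
    rw [Finset.sum_comm]
    rfl
  have hcmi : cmi (tensorId (⇑R) τ) = 0 := by
    have := entropy_eq τ hτ0 (tensorId (⇑R) τ) (hTpos τ hτ0) K' hK'1 L hL1 (hT τ).symm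
      (by
        rw [hpF, hK]
        have : ∀ l, K' l * ((1 : Matrix A A ℂ) ⊗ₖ ptrFst τ) * (K' l)ᴴ
            = (1 : Matrix A A ℂ) ⊗ₖ (K l * ptrFst τ * (K l)ᴴ) := by
          intro l
          simp only [K']
          rw [Matrix.conjTranspose_kronecker, ← Matrix.mul_kronecker_mul,
            ← Matrix.mul_kronecker_mul]
          simp
        simp only [this]
        ext x y
        simp only [Matrix.sum_apply, Matrix.kroneckerMap_apply, ← Finset.mul_sum])
      (by rw [hLM, hpC])
      (by
        rw [hLM, hpF]
        conv_rhs => rw [← hpB]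
        ext x y
        simp only [ptrC3, ptrSnd, Matrix.of_apply, Matrix.kroneckerMap_apply, Finset.mul_sum])
    unfold cmi
    rw [hpC, hpF, hpB]
    rw [hpF] at this
    linarith
  refine (iInf₂_le (tensorId (⇑R) τ) ⟨hTpos τ hτ0, htr, hcmi⟩).trans ?_
  unfold dMax
  refine sInf_le_sInf ?_
  rintro z ⟨l, rfl, hl⟩
  refine ⟨l, rfl, ?_⟩
  have := hTpos _ hl
  have e : tensorId (⇑R) ((2 : ℝ) ^ l • τ - ρAB)
      = (2 : ℝ) ^ l • tensorId (⇑R) τ - tensorId (⇑R) ρAB := by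
    simp only [hT, Matrix.mul_sub, Matrix.sub_mul, Finset.sum_sub_distrib, Matrix.mul_smul,
      Matrix.smul_mul, Finset.smul_sum]
  rw [e] at this
  exact this
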